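/- arXiv:0912.0679 — 2 statements merged into one kernel-verified Lean document; each statement's English description precedes it below -/
import Mathlib

section
/- Let k be a field and r, s positive integers with greatest common divisor (r,s). Then the quotient group H³(C_r×C_s, k*) = Z³(C_r×C_s,k*)/B³(C_r×C_s,k*) is isomorphic, as a group, to (k*/k*^{(r,s)}) × μ_r(k) × μ_s(k) × μ_{(r,s)}(k), where μ_n(k) = {α ∈ k* : α^n = 1} and k*^{(n)} = {α^n : α ∈ k*}. -/
def IsCocycle {k : Type*} [Field k] {G : Type*} [Group G] (φ : G → G → G → kˣ) : Prop :=
  ∀ x y z t : G, φ y z t * φ x (y * z) t * φ x y z = φ (x * y) z t * φ x y (z * t)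

def IsNormalized {k : Type*} [Field k] {G : Type*} [Group G] (φ : G → G → G → kˣ) : Prop :=
  ∀ x z : G, φ x 1 z = 1

def d2 {k : Type*} [Field k] {G : Type*} [Group G] (g : G → G → kˣ) : G → G → G → kˣ :=
  fun x y z => g y z * (g (x * y) z)⁻¹ * g x (y * z) * (g x y)⁻¹

def IsCoboundary {k : Type*} [Field k] {G : Type*} [Group G] (φ : G → G → G → kˣ) : Prop :=
  ∃ g : G → G → kˣ, φ = d2 g

/-- The group of 3-cocycles on `G` with coefficients in `kˣ`, under pointwise
multiplication. -/
def Z3 (k : Type*) [Field k] (G : Type*) [Group G] : Subgroup (G → G → G → kˣ) where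
  carrier := {φ : G → G → G → kˣ | IsCocycle φ}
  one_mem' := by
    show IsCocycle (1 : G → G → G → kˣ)
    intro x y z t
    simp
  mul_mem' := by
    intro a b ha hb
    replace ha : IsCocycle a := ha
    replace hb : IsCocycle b := hb
    show IsCocycle (a * b)
    intro x y z t
    simp only [Pi.mul_apply]
    simpa only [mul_assoc, mul_left_comm, mul_comm] using
      congrArg₂ (· * ·) (ha x y z t) (hb x y z t)
  inv_mem' := by
    intro a ha
    replace ha : IsCocycle a := ha
    show IsCocycle a⁻¹
    intro x y z t
    simp only [Pi.inv_apply]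
    simpa only [mul_inv, mul_assoc, mul_left_comm, mul_comm] using
      congrArg (·⁻¹) (ha x y z t)

/-- The group of 3-coboundaries on `G` with coefficients in `kˣ`. -/
def B3 (k : Type*) [Field k] (G : Type*) [Group G] : Subgroup (G → G → G → kˣ) where
  carrier := {φ : G → G → G → kˣ | IsCoboundary φ}
  one_mem' := by
    show IsCoboundary (1 : G → G → G → kˣ)
    exact ⟨1, by funext x y z; simp [d2]⟩
  mul_mem' := by
    intro a b ha hb
    obtain ⟨g, rfl⟩ : IsCoboundary a := ha
    obtain ⟨h, rfl⟩ : IsCoboundary b := hb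
    show IsCoboundary (d2 g * d2 h)
    refine ⟨g * h, ?_⟩
    funext x y z
    simp only [d2, Pi.mul_apply, mul_inv, mul_assoc, mul_left_comm, mul_comm]
  inv_mem' := by
    intro a ha
    obtain ⟨g, rfl⟩ : IsCoboundary a := ha
    show IsCoboundary (d2 g)⁻¹
    refine ⟨g⁻¹, ?_⟩
    funext x y z
    simp only [d2, Pi.inv_apply, Pi.mul_apply, mul_inv, inv_inv, mul_assoc, mul_left_comm,
      mul_comm]

/-- The third cohomology group `H³(G, kˣ) = Z³(G, kˣ)/B³(G, kˣ)`. -/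
abbrev H3 (k : Type*) [Field k] (G : Type*) [Group G] :=
  Z3 k G ⧸ (B3 k G).subgroupOf (Z3 k G)

/-- `μ_n(k)`, the group of `n`-th roots of unity in `k`. -/
def mu (k : Type*) [Field k] (n : ℕ) : Subgroup kˣ where
  carrier := {α : kˣ | α ^ n = 1}
  one_mem' := by
    show (1 : kˣ) ^ n = 1
    exact one_pow n
  mul_mem' := by
    intro a b ha hb
    show (a * b) ^ n = 1
    rw [mul_pow, show a ^ n = 1 from ha, show b ^ n = 1 from hb, one_mul]
  inv_mem' := by
    intro a ha
    show a⁻¹ ^ n = 1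
    rw [inv_pow, show a ^ n = 1 from ha, inv_one]

/-- `k*^{(n)} = {α^n : α ∈ k*}`, the subgroup of `n`-th powers in `kˣ`. -/
def powSubgroup (k : Type*) [Field k] (n : ℕ) : Subgroup kˣ where
  carrier := Set.range (· ^ n : kˣ → kˣ)
  one_mem' := ⟨1, one_pow n⟩
  mul_mem' := by
    rintro a b ⟨c, rfl⟩ ⟨d, rfl⟩
    exact ⟨c * d, mul_pow c d n⟩
  inv_mem' := by
    rintro a ⟨c, rfl⟩
    exact ⟨c⁻¹, inv_pow c n⟩


section Core

/-- Additive form of the 3-cocycle condition. -/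
def Coc {M A : Type*} [AddCommGroup M] [AddCommGroup A] (φ : M → M → M → A) : Prop :=
  ∀ x y z t : M, φ y z t - φ (x + y) z t + φ x (y + z) t - φ x y (z + t) + φ x y z = 0

/-- Additive form of the coboundary of a 2-cochain. -/
def dd {M A : Type*} [AddCommGroup M] [AddCommGroup A] (g : M → M → A) (x y z : M) : A :=
  g y z - g (x + y) z + g x (y + z) - g x y

/-- The explicit Eilenberg-Zilber homotopy in degree two. -/
def ezh {H K A : Type*} [AddCommGroup H] [AddCommGroup K] [AddCommGroup A]
    (φ : H × K → H × K → H × K → A) (p q : H × K) : A :=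
  φ (0, 0) (p.1, p.2) (q.1, q.2) - φ (0, 0) (0, p.2) (0, q.2) - φ (0, p.2) (p.1, 0) (0, q.2) + φ (0, p.2) (0, q.2) (p.1, 0) - φ (0, p.2+q.2) (p.1, 0) (q.1, 0) - φ (p.1, p.2) (0, 0) (q.1, q.2) + φ (p.1, p.2) (0, 0) (0, q.2) + φ (p.1, p.2) (0, q.2) (q.1, 0) + φ (0, 0) (0, 0) (p.1+q.1, p.2+q.2) - φ (0, 0) (0, 0) (0, p.2+q.2) - φ (0, 0) (0, p.2+q.2) (p.1+q.1, 0) - φ (0, 0) (0, 0) (p.1, p.2) + φ (0, 0) (0, 0) (0, p.2) + φ (0, 0) (0, p.2) (p.1, 0)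

/-- The (2,1) component of a 3-cochain on a product. -/
def p21 {H K A : Type*} [AddCommGroup H] [AddCommGroup K] [AddCommGroup A]
    (φ : H × K → H × K → H × K → A) (a b : H) (w : K) : A :=
  φ (a, 0) (b, 0) (0, w) - φ (a, 0) (0, w) (b, 0) + φ (0, w) (a, 0) (b, 0)

/-- The (1,2) component of a 3-cochain on a product. -/
def p12 {H K A : Type*} [AddCommGroup H] [AddCommGroup K] [AddCommGroup A]
    (φ : H × K → H × K → H × K → A) (a : H) (v w : K) : A :=
  φ (a, 0) (0, v) (0, w) - φ (0, v) (a, 0) (0, w) + φ (0, v) (0, w) (a, 0)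

variable {H K A : Type*} [AddCommGroup H] [AddCommGroup K] [AddCommGroup A]

set_option maxHeartbeats 4000000 in
theorem ez (φ : H × K → H × K → H × K → A) (h : Coc φ) (a b c : H) (u v w : K) :
    φ (a, u) (b, v) (c, w) = dd (ezh φ) (a, u) (b, v) (c, w) + φ (a, 0) (b, 0) (c, 0)
      + p21 φ a b w + p12 φ a v w + φ (0, u) (0, v) (0, w) := by
  unfold Coc at h
  simp only [dd, ezh, p21, p12]
  linear_combination (norm := skip)
    h (0, 0) (a, u) (b, v) (c, w)
      - h (0, 0) (0, u) (0, v) (0, w)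
      - h (0, u) (a, 0) (0, v) (0, w)
      + h (0, u) (0, v) (a, 0) (0, w)
      - h (0, u) (0, v) (0, w) (a, 0)
      - h (0, u + v) (a, 0) (b, 0) (0, w)
      + h (0, u + v) (a, 0) (0, w) (b, 0)
      - h (0, u + v) (0, w) (a, 0) (b, 0)
      - h (0, u + v + w) (a, 0) (b, 0) (c, 0)
      - h (a, u) (0, 0) (b, v) (c, w)
      + h (a, u) (0, 0) (0, v) (0, w)
      + h (a, u) (0, v) (b, 0) (0, w)
      - h (a, u) (0, v) (0, w) (b, 0)
      + h (a, u) (0, v + w) (b, 0) (c, 0)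
      + h (a, u) (b, v) (0, 0) (c, w)
      - h (a, u) (b, v) (0, 0) (0, w)
      - h (a, u) (b, v) (0, w) (c, 0)
      - h (a, u) (0, 0) (0, 0) (b + c, v + w)
      + h (a, u) (0, 0) (0, 0) (0, v + w)
      + h (a, u) (0, 0) (0, v + w) (b + c, 0)
      + h (a, u) (0, 0) (0, 0) (b, v)
      - h (a, u) (0, 0) (0, 0) (0, v)
      - h (a, u) (0, 0) (0, v) (b, 0)
      + h (0, 0) (0, 0) (a + b, u + v) (c, w)
      - h (0, 0) (0, 0) (0, u + v) (0, w)
      - h (0, 0) (0, u + v) (a + b, 0) (0, w)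
      + h (0, 0) (0, u + v) (0, w) (a + b, 0)
      - h (0, 0) (0, u + v + w) (a + b, 0) (c, 0)
      - h (0, 0) (a + b, u + v) (0, 0) (c, w)
      + h (0, 0) (a + b, u + v) (0, 0) (0, w)
      + h (0, 0) (a + b, u + v) (0, w) (c, 0)
      - h (0, 0) (0, 0) (a, u) (b + c, v + w)
      + h (0, 0) (0, 0) (0, u) (0, v + w)
      + h (0, 0) (0, u) (a, 0) (0, v + w)
      - h (0, 0) (0, u) (0, v + w) (a, 0)
      + h (0, 0) (0, u + v + w) (a, 0) (b + c, 0)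
      + h (0, 0) (a, u) (0, 0) (b + c, v + w)
      - h (0, 0) (a, u) (0, 0) (0, v + w)
      - h (0, 0) (a, u) (0, v + w) (b + c, 0)
      + h (0, 0) (0, 0) (a, u) (b, v)
      - h (0, 0) (0, 0) (0, u) (0, v)
      - h (0, 0) (0, u) (a, 0) (0, v)
      + h (0, 0) (0, u) (0, v) (a, 0)
      - h (0, 0) (0, u + v) (a, 0) (b, 0)
      - h (0, 0) (a, u) (0, 0) (b, v)
      + h (0, 0) (a, u) (0, 0) (0, v)
      + h (0, 0) (a, u) (0, v) (b, 0)
  simp only [Prod.mk_add_mk, add_zero, zero_add, add_assoc]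
  abel

theorem p21_coc (φ : H × K → H × K → H × K → A) (h : Coc φ) (a b c : H) (w : K) :
    p21 φ b c w - p21 φ (a + b) c w + p21 φ a (b + c) w - p21 φ a b w = 0 := by
  unfold Coc at h
  simp only [p21]
  linear_combination (norm := skip)
    h (a, 0) (b, 0) (c, 0) (0, w) - h (a, 0) (b, 0) (0, w) (c, 0)
      + h (a, 0) (0, w) (b, 0) (c, 0) - h (0, w) (a, 0) (b, 0) (c, 0)
  simp only [Prod.mk_add_mk, add_zero, zero_add, add_assoc]
  abel

theorem p12_coc (φ : H × K → H × K → H × K → A) (h : Coc φ) (a : H) (u v w : K) :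
    p12 φ a v w - p12 φ a (u + v) w + p12 φ a u (v + w) - p12 φ a u v = 0 := by
  unfold Coc at h
  simp only [p12]
  linear_combination (norm := skip)
    - h (a, 0) (0, u) (0, v) (0, w) + h (0, u) (a, 0) (0, v) (0, w)
      - h (0, u) (0, v) (a, 0) (0, w) + h (0, u) (0, v) (0, w) (a, 0)
  simp only [Prod.mk_add_mk, add_zero, zero_add, add_assoc]
  abel

theorem p_mixed (φ : H × K → H × K → H × K → A) (h : Coc φ) (a b : H) (v w : K) :
    p12 φ b v w - p12 φ (a + b) v w + p12 φ a v w
      + (p21 φ a b w - p21 φ a b (v + w) + p21 φ a b v) = 0 := by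
  unfold Coc at h
  simp only [p12, p21]
  linear_combination (norm := skip)
    h (a, 0) (b, 0) (0, v) (0, w) - h (a, 0) (0, v) (b, 0) (0, w)
      + h (a, 0) (0, v) (0, w) (b, 0) + h (0, v) (a, 0) (b, 0) (0, w)
      - h (0, v) (a, 0) (0, w) (b, 0) + h (0, v) (0, w) (a, 0) (b, 0)
  simp only [Prod.mk_add_mk, add_zero, zero_add, add_assoc]
  abel

end Core

section Cyclic

/-- The carry in the addition of two residues modulo `r`. -/
def cy {r : ℕ} (i j : ZMod r) : ℕ := (i.val + j.val) / r

variable {r : ℕ} [NeZero r] {B : Type*} [AddCommGroup B]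

theorem cy_spec (i j : ZMod r) : i.val + j.val = (i + j).val + r * cy i j := by
  rw [ZMod.val_add, cy, Nat.mod_add_div]

theorem cy_coc (i j k : ZMod r) : cy j k + cy i (j + k) = cy i j + cy (i + j) k := by
  have h1 := cy_spec j k
  have h2 := cy_spec i (j + k)
  have h3 := cy_spec i j
  have h4 := cy_spec (i + j) k
  rw [← add_assoc i j k] at h2
  have hr : 0 < r := Nat.pos_of_ne_zero (NeZero.ne r)
  apply Nat.eq_of_mul_eq_mul_left hr
  rw [mul_add, mul_add]
  omega

theorem cy_zero_left (i : ZMod r) : cy 0 i = 0 := by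
  simp [cy, Nat.div_eq_of_lt (ZMod.val_lt i)]

theorem cy_zero_right (i : ZMod r) : cy i 0 = 0 := by
  simp [cy, Nat.div_eq_of_lt (ZMod.val_lt i)]

theorem cy_of_one (hr : r = 1) (i j : ZMod r) : cy i j = 0 := by
  have h1 := ZMod.val_lt i
  have h2 := ZMod.val_lt j
  have : i.val + j.val < r := by omega
  simp [cy, Nat.div_eq_of_lt this]

/-- smul form of `cy_spec`. -/
theorem cy_smul (i j : ZMod r) (m : B) :
    i.val • m + j.val • m - (i + j).val • m = cy i j • r • m := by
  have h := congrArg (· • m) (cy_spec i j)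
  simp only [add_smul, mul_comm r, mul_smul] at h
  rw [h]; abel

theorem cy_coc_smul (i j k : ZMod r) (m : B) :
    cy j k • m - cy (i + j) k • m + cy i (j + k) • m - cy i j • m = 0 := by
  have h := congrArg (· • m) (cy_coc i j k)
  simp only [add_smul] at h
  linear_combination (norm := abel) h

/-- Partial sums. -/
def S (f : ZMod r → B) (n : ℕ) : B := ∑ l ∈ Finset.range n, f (l : ZMod r)

theorem S_succ (f : ZMod r → B) (n : ℕ) : S f (n + 1) = S f n + f n := by
  simp [S, Finset.sum_range_succ]

theorem S_zero (f : ZMod r → B) : S f 0 = 0 := by simp [S]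

theorem S_add_r (f : ZMod r → B) (n : ℕ) : S f (n + r) = S f n + S f r := by
  induction n with
  | zero => simp [S_zero]
  | succ n ih =>
    rw [show n + 1 + r = (n + r) + 1 by ring, S_succ, S_succ, ih]
    simp; abel

theorem S_add_mul (f : ZMod r → B) (n m : ℕ) : S f (n + r * m) = S f n + m • S f r := by
  induction m with
  | zero => simp
  | succ m ih =>
    rw [show n + r * (m + 1) = (n + r * m) + r by ring, S_add_r, ih, succ_nsmul]; abel

theorem S_cy (f : ZMod r → B) (i j : ZMod r) :
    S f (i.val + j.val) = S f (i + j).val + cy i j • S f r := by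
  rw [cy_spec, S_add_mul]

/-- The full sum is shift invariant. -/
theorem S_shift (f : ZMod r → B) : S (fun i => f (i + 1)) r = S f r := by
  have h : ∀ n, S (fun i => f (i + 1)) n = S f (n + 1) - f 0 := by
    intro n
    induction n with
    | zero => simp [S_succ, S_zero]
    | succ n ih => rw [S_succ, ih, S_succ f (n + 1)]; push_cast; abel
  rw [h, S_succ]; simp

theorem C1 (N : ZMod r → B) (m : B) (h : ∀ i j, N i + N j - N (i + j) = cy i j • m)
    (hm : r = 1 → m = 0) : (∀ i, N i = i.val • N 1) ∧ r • N 1 = m := by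
  have h0 : N 0 = 0 := by
    have := h 0 0
    simpa [cy_zero_left] using this
  have hr : 0 < r := Nat.pos_of_ne_zero (NeZero.ne r)
  have key : ∀ n : ℕ, n < r → N (n : ZMod r) = n • N 1 := by
    intro n
    induction n with
    | zero => intro _; simp [h0]
    | succ n ih =>
      intro hn
      have h1 := h n 1
      have : cy (n : ZMod r) 1 = 0 := by
        have h2 : (n : ZMod r).val = n := ZMod.val_cast_of_lt (by omega)
        have h3 : (1 : ZMod r).val = 1 := by
          have := ZMod.val_cast_of_lt (n := r) (a := 1) (by omega)
          simpa using this
        rw [cy, h2, h3]; exact Nat.div_eq_of_lt hn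
      rw [this, ih (by omega), zero_smul] at h1
      push_cast
      rw [succ_nsmul]
      exact (sub_eq_zero.mp h1).symm
  refine ⟨fun i => ?_, ?_⟩
  · have := key i.val (ZMod.val_lt i)
    rwa [ZMod.natCast_zmod_val] at this
  · by_cases h1 : r = 1
    · subst h1
      rw [hm rfl, show (1 : ZMod 1) = 0 from Subsingleton.elim _ _, h0, smul_zero]
    · obtain ⟨n, rfl⟩ : ∃ n, r = n + 1 := ⟨r - 1, by omega⟩
      have h2 : (n : ZMod (n + 1)).val = n := ZMod.val_cast_of_lt (by omega)
      have h3 : (1 : ZMod (n + 1)).val = 1 := by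
        have := ZMod.val_cast_of_lt (n := n + 1) (a := 1) (by omega)
        simpa using this
      have h4 := h n 1
      have h5 : cy (n : ZMod (n + 1)) 1 = 1 := by
        rw [cy, h2, h3]; exact Nat.div_self hr
      have h6 : (n : ZMod (n + 1)) + 1 = 0 := by
        have := ZMod.natCast_self (n + 1)
        push_cast at this; exact this
      rw [h5, h6, h0, key n (by omega), one_smul, sub_zero] at h4
      rw [succ_nsmul, h4]

theorem C2 (f : ZMod r → ZMod r → B)
    (h : ∀ i j k, f j k - f (i + j) k + f i (j + k) - f i j = 0) :
    ∃ (g : ZMod r → B) (m : B), (r = 1 → m = 0) ∧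
      ∀ i j, f i j = cy i j • m + (g i + g j - g (i + j)) := by
  let T : ℕ → B := S (fun l => f l 1)
  have hi0 : ∀ i, f i 0 = f 0 0 := by
    intro i
    have := h i 0 0
    simp only [add_zero] at this
    linear_combination (norm := abel) - this
  have key : ∀ (i : ZMod r) (n : ℕ), f i (n : ZMod r) = f 0 0 + T (i.val + n) - T i.val - T n := by
    intro i n
    induction n with
    | zero => simp [T, S_zero, hi0]
    | succ n ih =>
      have h1 := h i n 1
      rw [← add_assoc, show T (i.val + n + 1) = _ from S_succ _ _, show T (n + 1) = _ from S_succ _ _]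
      push_cast
      rw [ZMod.natCast_zmod_val]
      linear_combination (norm := skip) h1 + ih
      simp only [T]
      abel
  refine ⟨fun i => f 0 0 - T i.val, if r = 1 then 0 else T r, fun h => by simp [h], fun i j => ?_⟩
  have h1 := key i j.val
  rw [ZMod.natCast_zmod_val] at h1
  rw [h1, show T (i.val + j.val) = _ from S_cy _ _ _]
  split_ifs with hr
  · rw [cy_of_one hr]; simp [T]; abel
  · simp only [T]; abel

theorem C3 (f : ZMod r → ZMod r → ZMod r → B) (h : Coc f) :
    ∃ (g : ZMod r → ZMod r → B) (m : B), r • m = 0 ∧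
      ∀ i j k, f i j k = (i.val * cy j k) • m + dd g i j k := by
  let T : ZMod r → ℕ → B := fun i => S (fun l => f i l 1)
  have key : ∀ (i j : ZMod r) (n : ℕ), f i j (n : ZMod r) =
      f i j 0 + T j n - T (i + j) n + T i (j.val + n) - T i j.val := by
    intro i j n
    induction n with
    | zero => simp [T, S_zero]
    | succ n ih =>
      have h1 := h i j n 1
      rw [← add_assoc]
      simp only [T, S_succ] at ih ⊢
      push_cast
      rw [ZMod.natCast_zmod_val]
      linear_combination (norm := abel) ih - h1
  have hN : ∀ i j, T i r + T j r - T (i + j) r = cy i j • (0 : B) := by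
    intro i j
    have h1 := key i j r
    have h2 : T i (j.val + r) = T i j.val + T i r := S_add_r _ _
    rw [h2] at h1
    simp only [ZMod.natCast_self, smul_zero] at h1 ⊢
    linear_combination (norm := abel) -h1
  obtain ⟨hN1, hN2⟩ := C1 (fun i => T i r) 0 hN (fun _ => rfl)
  refine ⟨fun i j => T i j.val - f i j 0, T 1 r, hN2, fun i j k => ?_⟩
  have h1 := key i j k.val
  rw [ZMod.natCast_zmod_val] at h1
  have h2 : T i (j.val + k.val) = _ := S_cy _ _ _
  have h3 : S (fun l => f i l 1) r = i.val • T 1 r := hN1 i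
  rw [h2, h3] at h1
  have h4 := h i j k 0
  rw [mul_comm, mul_smul]
  simp only [dd, add_zero] at h4 ⊢
  linear_combination (norm := skip) h1 + h4
  simp only [T]
  abel

end Cyclic

section Main

variable {r s : ℕ} [NeZero r] [NeZero s] {A : Type*} [AddCommGroup A]

/-- The explicit standard cocycles. -/
def Psi (r s : ℕ) {A : Type*} [AddCommGroup A] (a x y a' : A) (p q t : ZMod r × ZMod s) : A :=
  (p.1.val * cy q.1 t.1) • a + (cy p.1 q.1 * t.2.val) • x + (p.1.val * cy q.2 t.2) • y
    + (p.2.val * cy q.2 t.2) • a'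

/-- The basic one-variable cocycle. -/
theorem one_var (a : A) (ha : r • a = 0) : Coc (fun i j k : ZMod r => (i.val * cy j k) • a) := by
  intro x y z t
  have h1 := cy_coc_smul y z t a
  have h2 := congrArg (cy z t • ·) (cy_smul x y a)
  simp only [ha, smul_zero, smul_add, smul_sub] at h2
  have h3 := congrArg (x.val • ·) h1
  simp only [smul_zero, smul_add, smul_sub] at h3
  have e : ∀ m n : ℕ, m • n • a = (n * m) • a := fun m n => by rw [mul_comm, mul_smul]
  simp only [e] at h2
  simp only [mul_smul] at h2 h3 ⊢
  linear_combination (norm := abel) h2 - h3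

theorem Psi_coc (a x y a' : A) (ha : r • a = 0) (ha' : s • a' = 0) (hxy : s • x + r • y = 0) :
    Coc (Psi r s a x y a') := by
  intro p q t u
  have h1 := one_var a ha p.1 q.1 t.1 u.1
  have h2 := one_var a' ha' p.2 q.2 t.2 u.2
  have h3 := cy_coc_smul p.1 q.1 t.1 (u.2.val • x)
  have h4 := congrArg (cy p.1 q.1 • ·) (cy_smul t.2 u.2 x)
  have h5 := congrArg (p.1.val • ·) (cy_coc_smul q.2 t.2 u.2 y)
  have h6 := congrArg (cy t.2 u.2 • ·) (cy_smul p.1 q.1 y)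
  have h7 := congrArg (fun z => cy p.1 q.1 • cy t.2 u.2 • z) hxy
  have h8 : cy t.2 u.2 • cy p.1 q.1 • r • y = cy p.1 q.1 • cy t.2 u.2 • r • y := smul_comm _ _ _
  have e : ∀ m : ℕ, cy t.2 u.2 • m • y = m • cy t.2 u.2 • y := fun m => smul_comm _ _ _
  simp only [smul_zero, smul_add, smul_sub, e] at h4 h5 h6 h7 h8
  simp only [Psi, Prod.fst_add, Prod.snd_add]
  simp only [mul_smul] at h1 h2 ⊢
  linear_combination (norm := abel) h1 + h2 + h3 + h4 - h5 + h6 + h7 + h8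

theorem Psi_bdry (b : A) :
    Psi r s 0 (r • b) (-(s • b)) 0 = dd (fun p q => (p.1.val * q.2.val) • b) := by
  funext p q t
  have h1 := cy_smul p.1 q.1 (t.2.val • b)
  have h2 := congrArg (p.1.val • ·) (cy_smul q.2 t.2 b)
  have e : cy p.1 q.1 • t.2.val • r • b = cy p.1 q.1 • r • t.2.val • b := by
    rw [smul_comm t.2.val]
  simp only [smul_add, smul_sub] at h2
  simp only [Psi, dd, Prod.fst_add, Prod.snd_add, mul_smul, smul_zero, smul_neg]
  linear_combination (norm := abel) e - h1 + h2

theorem cy_comm (i j : ZMod r) : cy i j = cy j i := by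
  rw [cy, cy, add_comm]

theorem S_tele (ρ : ZMod r → A) (c : A) (n : ℕ) :
    S (fun i => ρ i - ρ (i + 1) + c) n = ρ 0 - ρ n + n • c := by
  induction n with
  | zero => simp [S_zero]
  | succ n ih => rw [S_succ, ih, succ_nsmul]; push_cast; abel

theorem S_cy_one : S (fun i : ZMod r => (cy 1 i : ℤ)) r = (1 : ZMod r).val := by
  have h1 := S_tele (fun i : ZMod r => (i.val : ℤ)) ((1 : ZMod r).val : ℤ) r
  have h2 : (fun i : ZMod r => (i.val : ℤ) - (i + 1).val + ((1 : ZMod r).val : ℤ)) =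
      fun i => (r : ℤ) * (cy 1 i : ℤ) := by
    funext i
    have := cy_spec (1 : ZMod r) i
    rw [add_comm i 1]
    zify at this
    linear_combination this
  rw [h2] at h1
  have h3 : S (fun i : ZMod r => (r : ℤ) * (cy 1 i : ℤ)) r
      = r * S (fun i : ZMod r => (cy 1 i : ℤ)) r := by
    simp only [S, Finset.mul_sum]
  rw [h3] at h1
  have hr : (r : ℤ) ≠ 0 := by exact_mod_cast NeZero.ne r
  apply mul_left_cancel₀ hr
  simpa using h1

theorem sum_lemma (ρ : ZMod r → A) (x c : A)
    (h : ∀ i, cy 1 i • x = ρ i - ρ (i + 1) + c) : (1 : ZMod r).val • x = r • c := by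
  have h1 := S_tele ρ c r
  rw [show (fun i => ρ i - ρ (i + 1) + c) = fun i => cy 1 i • x from (funext h).symm] at h1
  have h2 : S (fun i : ZMod r => cy 1 i • x) r = S (fun i : ZMod r => (cy 1 i : ℤ)) r • x := by
    simp only [S, Finset.sum_smul, natCast_zsmul]
  rw [h2, S_cy_one] at h1
  simpa only [ZMod.natCast_self, sub_self, zero_add, natCast_zsmul] using h1

theorem one_val_smul (hr : r ≠ 1) (x : A) : (1 : ZMod r).val • x = x := by
  have h0 : 0 < r := Nat.pos_of_ne_zero (NeZero.ne r)
  have := ZMod.val_cast_of_lt (n := r) (a := 1) (by omega)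
  rw [Nat.cast_one] at this
  rw [this, one_smul]

theorem Psi_inj (a x y a' : A) (ha : r • a = 0) (ha' : s • a' = 0) (hxy : s • x + r • y = 0)
    (g : ZMod r × ZMod s → ZMod r × ZMod s → A) (h : Psi r s a x y a' = dd g) :
    a = 0 ∧ a' = 0 ∧ ∃ b, x = r • b ∧ y = -(s • b) := by
  have H : ∀ p q t, Psi r s a x y a' p q t = dd g p q t := fun p q t => by rw [h]
  refine ⟨?_, ?_, ?_⟩
  · by_cases hr : r = 1
    · simpa [hr] using ha
    have := sum_lemma (r := r) (fun i => g (i, 0) (1, 0) - g (1, 0) (i, 0)) a 0 (fun i => by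
      have h1 := H (1, 0) (i, 0) (1, 0)
      simp only [Psi, dd, cy_zero_left, mul_zero, zero_smul, add_zero, Prod.mk_add_mk,
        ZMod.val_zero, mul_smul, one_val_smul hr] at h1
      rw [cy_comm, h1, add_comm 1 i]
      abel)
    rwa [one_val_smul hr, smul_zero] at this
  · by_cases hr : s = 1
    · simpa [hr] using ha'
    have := sum_lemma (r := s) (fun i => g (0, i) (0, 1) - g (0, 1) (0, i)) a' 0 (fun i => by
      have h1 := H (0, 1) (0, i) (0, 1)
      simp only [Psi, dd, cy_zero_left, mul_zero, zero_mul, zero_smul, add_zero, zero_add,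
        Prod.mk_add_mk, ZMod.val_zero, mul_smul, one_val_smul hr] at h1
      rw [cy_comm, h1, add_comm 1 i]
      abel)
    rwa [one_val_smul hr, smul_zero] at this
  · by_cases hr : r = 1
    · refine ⟨x, by simp [hr], ?_⟩
      rw [hr, one_smul] at hxy
      exact (neg_eq_of_add_eq_zero_right hxy).symm
    by_cases hs : s = 1
    · refine ⟨-y, ?_, by simp [hs]⟩
      rw [hs, one_smul] at hxy
      rw [smul_neg]
      exact eq_neg_of_add_eq_zero_left hxy
    let ψ : ZMod r → ZMod s → A := fun h k => g (h, 0) (0, k) - g (0, k) (h, 0)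
    refine ⟨ψ 1 1, ?_, ?_⟩
    · have := sum_lemma (r := r) (fun i => ψ i 1) x (ψ 1 1) (fun i => by
        have h1 := H (1, 0) (i, 0) (0, 1)
        have h2 := H (1, 0) (0, 1) (i, 0)
        have h3 := H (0, 1) (1, 0) (i, 0)
        simp only [Psi, dd, cy_zero_left, cy_zero_right, mul_zero, zero_mul, zero_smul, add_zero,
          zero_add, Prod.mk_add_mk, ZMod.val_zero, mul_smul, one_val_smul hs] at h1 h2 h3
        rw [add_comm i 1]
        linear_combination (norm := skip) h1 - h2 + h3
        simp only [ψ]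
        abel)
      rwa [one_val_smul hr] at this
    · have := sum_lemma (r := s) (fun i => - ψ 1 i) y (- ψ 1 1) (fun i => by
        have h1 := H (1, 0) (0, 1) (0, i)
        have h2 := H (0, 1) (1, 0) (0, i)
        have h3 := H (0, 1) (0, i) (1, 0)
        simp only [Psi, dd, cy_zero_left, cy_zero_right, mul_zero, zero_mul, zero_smul, add_zero,
          zero_add, Prod.mk_add_mk, ZMod.val_zero, mul_smul, one_val_smul hr] at h1 h2 h3
        rw [add_comm i 1]
        linear_combination (norm := skip) h1 - h2 + h3
        simp only [ψ]
        abel)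
      rwa [one_val_smul hs, smul_neg] at this

theorem Psi_surj (φ : ZMod r × ZMod s → ZMod r × ZMod s → ZMod r × ZMod s → A) (h : Coc φ) :
    ∃ (a x y a' : A) (g : ZMod r × ZMod s → ZMod r × ZMod s → A),
      r • a = 0 ∧ s • a' = 0 ∧ s • x + r • y = 0 ∧ φ = Psi r s a x y a' + dd g := by
  obtain ⟨g₁, a, ha, h30⟩ := C3 (fun i j k => φ (i, 0) (j, 0) (k, 0)) (fun x y z t => by
    have := h (x, 0) (y, 0) (z, 0) (t, 0)
    simpa only [Prod.mk_add_mk, add_zero] using this)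
  obtain ⟨g₂, a', ha', h03⟩ := C3 (fun i j k => φ (0, i) (0, j) (0, k)) (fun x y z t => by
    have := h (0, x) (0, y) (0, z) (0, t)
    simpa only [Prod.mk_add_mk, add_zero] using this)
  obtain ⟨ψ, n, hn, h21⟩ := C2 (fun i j => p21 φ i j) (fun i j k => by
    funext w
    exact p21_coc φ h i j k w)
  have h21' : ∀ i j w, p21 φ i j w = cy i j • n w + (ψ i w + ψ j w - ψ (i + j) w) :=
    fun i j w => congrFun (h21 i j) w
  let q : ZMod r → ZMod s → ZMod s → A :=
    fun i v w => p12 φ i v w + (ψ i v + ψ i w - ψ i (v + w))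
  obtain ⟨hq, hqr⟩ := C1 q (fun v w => - (n v + n w - n (v + w))) (fun i j => by
    funext v w
    have h1 := p_mixed φ h i j v w
    rw [h21', h21', h21'] at h1
    simp only [q, Pi.add_apply, Pi.sub_apply, Pi.smul_apply, smul_neg, smul_add, smul_sub]
    linear_combination (norm := abel) h1) (fun hr => by
    funext v w
    simp [hn hr])
  obtain ⟨e, y, hy, hC⟩ := C2 (q 1) (fun u v w => by
    have h1 := p12_coc φ h 1 u v w
    simp only [q, add_assoc]
    linear_combination (norm := abel) h1)
  obtain ⟨hN, hx⟩ := C1 (fun w => n w + r • e w) (-(r • y)) (fun v w => by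
    have h1 := congrFun (congrFun hqr v) w
    simp only [Pi.smul_apply, hC, smul_add, smul_sub] at h1
    rw [smul_comm r] at h1
    rw [smul_neg]
    linear_combination (norm := abel) h1) (fun hs => by simp [hy hs])
  obtain ⟨x, hxdef⟩ : ∃ x, x = n 1 + r • e 1 := ⟨_, rfl⟩
  simp only [← hxdef] at hN hx
  refine ⟨a, x, y, a', fun p t => ezh φ p t + g₁ p.1 t.1 + g₂ p.2 t.2
    + (ψ p.1 t.2 - p.1.val • e t.2), ha, ha', by rw [hx]; abel, ?_⟩
  funext ⟨i, u⟩ ⟨j, v⟩ ⟨k, w⟩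
  have e0 := ez φ h i j k u v w
  have e1 := h30 i j k
  have e2 := h03 u v w
  have e3 := h21' i j w
  have e4 := congrFun (congrFun (hq i) v) w
  have e5 := congrArg (cy i j • ·) (hN w)
  have e6 := cy_smul i j (e w)
  simp only [Pi.smul_apply, hC, smul_add, smul_sub, q] at e4 e5
  simp only [Psi, dd, Pi.add_apply, Prod.mk_add_mk, mul_smul] at e0 e1 e2 ⊢
  linear_combination (norm := abel) e0 + e1 + e2 + e3 + e4 + e5 + e6

end Main

section Transfer

variable {k : Type*} [Field k] {r s : ℕ}

/-- The group `C_r × C_s` in multiplicative form. -/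
abbrev GG (r s : ℕ) := Multiplicative (ZMod r) × Multiplicative (ZMod s)

/-- From additive to multiplicative pairs. -/
def up (x : ZMod r × ZMod s) : GG r s := (Multiplicative.ofAdd x.1, Multiplicative.ofAdd x.2)

/-- From multiplicative to additive pairs. -/
def dn (x : GG r s) : ZMod r × ZMod s := (Multiplicative.toAdd x.1, Multiplicative.toAdd x.2)

theorem dn_mul (x y : GG r s) : dn (x * y) = dn x + dn y := rfl
theorem up_add (x y : ZMod r × ZMod s) : up (x + y) = up x * up y := rfl
theorem up_dn (x : GG r s) : up (dn x) = x := rfl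
theorem dn_up (x : ZMod r × ZMod s) : dn (up x) = x := rfl

/-- Additive version of a multiplicative cochain. -/
def toA (φ : GG r s → GG r s → GG r s → kˣ) (x y z : ZMod r × ZMod s) : Additive kˣ :=
  Additive.ofMul (φ (up x) (up y) (up z))

/-- Multiplicative version of an additive cochain. -/
def toM (f : ZMod r × ZMod s → ZMod r × ZMod s → ZMod r × ZMod s → Additive kˣ)
    (x y z : GG r s) : kˣ :=
  Additive.toMul (f (dn x) (dn y) (dn z))

theorem toA_toM (f : ZMod r × ZMod s → ZMod r × ZMod s → ZMod r × ZMod s → Additive kˣ) :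
    toA (toM f) = f := rfl

theorem toM_toA (φ : GG r s → GG r s → GG r s → kˣ) : toM (toA φ) = φ := rfl

theorem coc_toA (φ : GG r s → GG r s → GG r s → kˣ) (h : IsCocycle φ) : Coc (toA φ) := by
  intro x y z t
  have h1 : toA φ y z t + toA φ x (y + z) t + toA φ x y z
      = toA φ (x + y) z t + toA φ x y (z + t) := h (up x) (up y) (up z) (up t)
  linear_combination (norm := abel) h1

theorem coc_toM (f : ZMod r × ZMod s → ZMod r × ZMod s → ZMod r × ZMod s → Additive kˣ)
    (h : Coc f) : IsCocycle (toM f) := by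
  intro x y z t
  have h1 : f (dn y) (dn z) (dn t) + f (dn x) (dn y + dn z) (dn t) + f (dn x) (dn y) (dn z)
      = f (dn x + dn y) (dn z) (dn t) + f (dn x) (dn y) (dn z + dn t) := by
    linear_combination (norm := abel) h (dn x) (dn y) (dn z) (dn t)
  exact h1

theorem bdry_toM (f : ZMod r × ZMod s → ZMod r × ZMod s → ZMod r × ZMod s → Additive kˣ) :
    IsCoboundary (toM f) ↔ ∃ g, f = dd g := by
  constructor
  · rintro ⟨g, hg⟩
    refine ⟨fun x y => Additive.ofMul (g (up x) (up y)), ?_⟩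
    funext x y z
    have h1 : f x y z = Additive.ofMul (d2 g (up x) (up y) (up z)) := by rw [← hg]; rfl
    rw [h1]
    simp only [d2, dd, ofMul_mul, ofMul_inv, up_add]
    abel
  · rintro ⟨g, rfl⟩
    refine ⟨fun x y => Additive.toMul (g (dn x) (dn y)), ?_⟩
    funext x y z
    simp only [d2, toM, dd, toMul_add, toMul_sub, dn_mul, div_eq_mul_inv]

/-- Cocycles of the small complex. -/
def Zs (k : Type*) [Field k] (r s : ℕ) : Subgroup (kˣ × kˣ × kˣ × kˣ) where
  carrier := {z | z.1 ^ r = 1 ∧ z.2.2.2 ^ s = 1 ∧ z.2.1 ^ s * z.2.2.1 ^ r = 1}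
  one_mem' := by simp
  mul_mem' := by
    rintro ⟨a, x, y, b⟩ ⟨a', x', y', b'⟩ ⟨h1, h2, h3⟩ ⟨h1', h2', h3'⟩
    refine ⟨?_, ?_, ?_⟩
    · show (a * a') ^ r = 1
      rw [mul_pow, show a ^ r = 1 from h1, show a' ^ r = 1 from h1', one_mul]
    · show (b * b') ^ s = 1
      rw [mul_pow, show b ^ s = 1 from h2, show b' ^ s = 1 from h2', one_mul]
    · show (x * x') ^ s * (y * y') ^ r = 1
      rw [mul_pow, mul_pow, mul_mul_mul_comm, show x ^ s * y ^ r = 1 from h3,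
        show x' ^ s * y' ^ r = 1 from h3', one_mul]
  inv_mem' := by
    rintro ⟨a, x, y, b⟩ ⟨h1, h2, h3⟩
    refine ⟨?_, ?_, ?_⟩
    · show a⁻¹ ^ r = 1
      rw [inv_pow, show a ^ r = 1 from h1, inv_one]
    · show b⁻¹ ^ s = 1
      rw [inv_pow, show b ^ s = 1 from h2, inv_one]
    · show x⁻¹ ^ s * y⁻¹ ^ r = 1
      rw [inv_pow, inv_pow, ← mul_inv, show x ^ s * y ^ r = 1 from h3, inv_one]

/-- The explicit multiplicative cocycle. -/
def PsiM (z : kˣ × kˣ × kˣ × kˣ) : GG r s → GG r s → GG r s → kˣ :=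
  toM (Psi r s (Additive.ofMul z.1) (Additive.ofMul z.2.1) (Additive.ofMul z.2.2.1)
    (Additive.ofMul z.2.2.2))

theorem Psi_add {A : Type*} [AddCommGroup A] (a x y b a' x' y' b' : A)
    (p q t : ZMod r × ZMod s) :
    Psi r s (a + a') (x + x') (y + y') (b + b') p q t =
      Psi r s a x y b p q t + Psi r s a' x' y' b' p q t := by
  simp only [Psi, smul_add]
  abel

theorem PsiM_mul (z z' : kˣ × kˣ × kˣ × kˣ) :
    (PsiM (z * z') : GG r s → GG r s → GG r s → kˣ) = PsiM z * PsiM z' := by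
  funext p q t
  apply Additive.ofMul.injective
  exact Psi_add _ _ _ _ _ _ _ _ _ _ _

/-- Being a coboundary in the small complex. -/
def Bs (r s : ℕ) (z : kˣ × kˣ × kˣ × kˣ) : Prop :=
  z.1 = 1 ∧ z.2.2.2 = 1 ∧ ∃ b : kˣ, z.2.1 = b ^ r ∧ z.2.2.1 = (b ^ s)⁻¹

theorem PsiM_bdry [NeZero r] [NeZero s] (z : kˣ × kˣ × kˣ × kˣ) (hz : z ∈ Zs k r s) :
    IsCoboundary (PsiM z : GG r s → GG r s → GG r s → kˣ) ↔ Bs r s z := by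
  obtain ⟨a, x, y, a'⟩ := z
  obtain ⟨h1, h2, h3⟩ := hz
  rw [PsiM, bdry_toM]
  constructor
  · rintro ⟨g, hg⟩
    exact Psi_inj (A := Additive kˣ) a x y a' h1 h2 h3 g hg
  · rintro ⟨h4, h5, b, h6, h7⟩
    simp only at h4 h5 h6 h7
    subst h4 h5 h6 h7
    exact ⟨_, Psi_bdry (Additive.ofMul b)⟩

/-- The map from the small cocycles to cohomology. -/
def hom1 (k : Type*) [Field k] (r s : ℕ) [NeZero r] [NeZero s] :
    Zs k r s →* H3 k (GG r s) :=
  (QuotientGroup.mk' _).comp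
    { toFun := fun z => ⟨PsiM z.1, coc_toM _ (Psi_coc _ _ _ _ z.2.1 z.2.2.1 z.2.2.2)⟩
      map_one' := by
        have h := PsiM_mul (k := k) (r := r) (s := s) 1 1
        rw [mul_one] at h
        exact Subtype.ext (left_eq_mul.mp h)
      map_mul' := fun z z' => Subtype.ext (PsiM_mul z.1 z'.1) }

theorem hom1_ker [NeZero r] [NeZero s] (z : Zs k r s) : z ∈ (hom1 k r s).ker ↔ Bs r s z.1 := by
  rw [← PsiM_bdry z.1 z.2, MonoidHom.mem_ker]
  show ((_ : Z3 k (GG r s)) : H3 k (GG r s)) = 1 ↔ _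
  rw [QuotientGroup.eq_one_iff, Subgroup.mem_subgroupOf]
  rfl

theorem hom1_surj [NeZero r] [NeZero s] : Function.Surjective (hom1 k r s) := by
  intro c
  obtain ⟨⟨φ, hφ⟩, rfl⟩ := QuotientGroup.mk_surjective c
  obtain ⟨a, x, y, a', g, h1, h2, h3, h4⟩ := Psi_surj (toA φ) (coc_toA φ hφ)
  refine ⟨⟨(Additive.toMul a, Additive.toMul x, Additive.toMul y, Additive.toMul a'),
    h1, h2, h3⟩, ?_⟩
  refine QuotientGroup.eq.mpr ?_
  rw [Subgroup.mem_subgroupOf]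
  have h5 : φ = toM (Psi r s a x y a') * toM (dd g) := by
    rw [← toM_toA φ, h4]; rfl
  have h6 : IsCoboundary (toM (dd g)) := (bdry_toM (dd g)).mpr ⟨g, rfl⟩
  show (toM (Psi r s a x y a'))⁻¹ * φ ∈ B3 k (GG r s)
  rw [h5, inv_mul_cancel_left]
  exact h6

/-- The map from the small cocycles to the explicit group. -/
def hom2 (k : Type*) [Field k] (r s d r' s' : ℕ) (u v : ℤ) (hr : r = d * r') (hs : s = d * s') :
    Zs k r s →* (kˣ ⧸ powSubgroup k d) × mu k r × mu k s × mu k d where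
  toFun z := (QuotientGroup.mk (z.1.2.1 ^ u * (z.1.2.2.1 ^ v)⁻¹), ⟨z.1.1, z.2.1⟩,
    ⟨z.1.2.2.2, z.2.2.1⟩, ⟨z.1.2.1 ^ s' * z.1.2.2.1 ^ r', by
      have h := z.2.2.2
      show (_ : kˣ) ^ d = 1
      rw [mul_pow, ← pow_mul, ← pow_mul, mul_comm s', mul_comm r', ← hr, ← hs]
      exact h⟩)
  map_one' := by
    simp [Prod.ext_iff]
  map_mul' z z' := by
    refine Prod.ext ?_ (Prod.ext rfl (Prod.ext rfl (Subtype.ext ?_)))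
    · show (QuotientGroup.mk _ : kˣ ⧸ powSubgroup k d) = QuotientGroup.mk (_ * _)
      congr 1
      simp only [Subgroup.coe_mul, Prod.snd_mul, Prod.fst_mul, mul_zpow, mul_inv]
      exact mul_mul_mul_comm _ _ _ _
    · simp only [Subgroup.coe_mul, Prod.snd_mul, Prod.fst_mul, mul_pow]
      exact mul_mul_mul_comm _ _ _ _

theorem alg1 {A : Type*} [AddCommGroup A] {d r' s' : ℕ} {u v : ℤ}
    (huv : u * r' + v * s' = 1) (x y b : A) (h : s' • x + r' • y = 0)
    (hb : d • b = u • x + -(v • y)) : x = (d * r') • b ∧ y = -((d * s') • b) := by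
  simp only [← natCast_zsmul, Nat.cast_mul] at h hb ⊢
  constructor
  · linear_combination (norm := module) v • h - (r' : ℤ) • hb - huv • x
  · linear_combination (norm := module) u • h + (s' : ℤ) • hb - huv • y

theorem alg2 {A : Type*} [AddCommGroup A] {d r' s' : ℕ} {u v : ℤ}
    (huv : u * r' + v * s' = 1) (b : A) :
    d • b = u • ((d * r') • b) + -(v • (-((d * s') • b))) ∧
      s' • ((d * r') • b) + r' • (-((d * s') • b)) = 0 := by
  simp only [← natCast_zsmul, Nat.cast_mul]
  constructor
  · linear_combination (norm := module) - (d : ℤ) • huv • b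
  · module

theorem alg3 {A : Type*} [AddCommGroup A] {d r' s' : ℕ} {u v : ℤ}
    (huv : u * r' + v * s' = 1) (p q : A) (hp : d • p = 0) :
    ∃ x y : A, (d * s') • x + (d * r') • y = 0 ∧ u • x + -(v • y) = q ∧ s' • x + r' • y = p := by
  refine ⟨r' • q + v • p, u • p - s' • q, ?_, ?_, ?_⟩
  all_goals simp only [← natCast_zsmul, Nat.cast_mul] at hp ⊢
  · linear_combination (norm := module) (v * s' + u * r') • hp
  · linear_combination (norm := module) huv • q
  · linear_combination (norm := module) huv • p

theorem hom2_ker {r s d r' s' : ℕ} {u v : ℤ} (hr : r = d * r') (hs : s = d * s')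
    (huv : u * r' + v * s' = 1) (z : Zs k r s) :
    z ∈ (hom2 k r s d r' s' u v hr hs).ker ↔ Bs r s z.1 := by
  obtain ⟨⟨a, x, y, a'⟩, hz⟩ := z
  rw [MonoidHom.mem_ker]
  have key : (hom2 k r s d r' s' u v hr hs) ⟨(a, x, y, a'), hz⟩ = 1 ↔
      (∃ b : kˣ, b ^ d = x ^ u * (y ^ v)⁻¹) ∧ a = 1 ∧ a' = 1 ∧ x ^ s' * y ^ r' = 1 := by
    rw [Prod.ext_iff, Prod.ext_iff, Prod.ext_iff]
    refine and_congr ?_ (and_congr ?_ (and_congr ?_ ?_))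
    · exact QuotientGroup.eq_one_iff _
    · exact Subtype.ext_iff
    · exact Subtype.ext_iff
    · exact Subtype.ext_iff
  rw [key]
  show _ ↔ a = 1 ∧ a' = 1 ∧ ∃ b : kˣ, x = b ^ r ∧ y = (b ^ s)⁻¹
  constructor
  · rintro ⟨⟨b, hb⟩, h1, h2, h3⟩
    subst hr hs
    have h4 := alg1 (A := Additive kˣ) huv (Additive.ofMul x) (Additive.ofMul y)
      (Additive.ofMul b) h3 hb
    exact ⟨h1, h2, b, h4.1, h4.2⟩
  · rintro ⟨h1, h2, b, rfl, rfl⟩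
    subst hr hs
    have h4 := alg2 (A := Additive kˣ) (d := d) huv (Additive.ofMul b)
    exact ⟨⟨b, h4.1⟩, h1, h2, h4.2⟩

theorem hom2_surj {r s d r' s' : ℕ} {u v : ℤ} (hr : r = d * r') (hs : s = d * s')
    (huv : u * r' + v * s' = 1) : Function.Surjective (hom2 k r s d r' s' u v hr hs) := by
  rintro ⟨q, ⟨a, ha⟩, ⟨a', ha'⟩, ⟨p, hp⟩⟩
  obtain ⟨q, rfl⟩ := QuotientGroup.mk_surjective q
  subst hr hs
  obtain ⟨x, y, h1, h2, h3⟩ := alg3 (A := Additive kˣ) huv (Additive.ofMul p)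
    (Additive.ofMul q) hp
  refine ⟨⟨(a, Additive.toMul x, Additive.toMul y, a'), ha, ha', h1⟩, ?_⟩
  refine Prod.ext ?_ (Prod.ext rfl (Prod.ext rfl (Subtype.ext h3)))
  exact congrArg (QuotientGroup.mk : kˣ → kˣ ⧸ powSubgroup k d) h2

theorem eq_iff_of_hom {X Y : Type*} [Group X] [MulOneClass Y] (f : X →* Y) (x x' : X) :
    f x = f x' ↔ f (x⁻¹ * x') = 1 := by
  constructor
  · intro h
    rw [map_mul, ← h, ← map_mul, inv_mul_cancel, map_one]
  · intro h
    rw [← mul_one (f x), ← h, ← map_mul, mul_inv_cancel_left]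

theorem equiv_of_ker {X Y Z : Type*} [Group X] [MulOneClass Y] [MulOneClass Z]
    (f : X →* Y) (g : X →* Z)
    (hf : Function.Surjective f) (hg : Function.Surjective g) (h : ∀ x, f x = 1 ↔ g x = 1) :
    Nonempty (Y ≃* Z) := by
  have hfg : ∀ x x', f x = f x' ↔ g x = g x' := fun x x' => by
    rw [eq_iff_of_hom f, eq_iff_of_hom g, h]
  have hF : ∀ x, g (Function.surjInv hf (f x)) = g x := fun x =>
    (hfg _ _).mp (Function.surjInv_eq hf (f x))
  have hG : ∀ x, f (Function.surjInv hg (g x)) = f x := fun x =>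
    (hfg _ _).mpr (Function.surjInv_eq hg (g x))
  refine ⟨{ toFun := fun y => g (Function.surjInv hf y)
            invFun := fun z => f (Function.surjInv hg z)
            left_inv := ?_
            right_inv := ?_
            map_mul' := ?_ }⟩
  · intro y
    obtain ⟨x, rfl⟩ := hf y
    simp only [hF, hG]
  · intro z
    obtain ⟨x, rfl⟩ := hg z
    simp only [hF, hG]
  · intro y y'
    obtain ⟨x, rfl⟩ := hf y
    obtain ⟨x', rfl⟩ := hf y'
    simp only [← map_mul, hF]

end Transfer

theorem statement3 (k : Type*) [Field k] (r s : ℕ) (hr : 0 < r) (hs : 0 < s) :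
    Nonempty (H3 k (Multiplicative (ZMod r) × Multiplicative (ZMod s)) ≃*
      (kˣ ⧸ powSubgroup k (Nat.gcd r s)) × mu k r × mu k s × mu k (Nat.gcd r s)) := by
  have : NeZero r := ⟨hr.ne'⟩
  have : NeZero s := ⟨hs.ne'⟩
  obtain ⟨r', hr'⟩ := Nat.gcd_dvd_left r s
  obtain ⟨s', hs'⟩ := Nat.gcd_dvd_right r s
  obtain ⟨u, v, huv⟩ : ∃ u v : ℤ, u * r' + v * s' = 1 := by
    refine ⟨Nat.gcdA r s, Nat.gcdB r s, ?_⟩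
    have h := Nat.gcd_eq_gcd_ab r s
    have hd : ((Nat.gcd r s : ℕ) : ℤ) ≠ 0 := by
      exact_mod_cast (Nat.gcd_pos_of_pos_left s hr).ne'
    apply mul_left_cancel₀ hd
    have e1 : (r : ℤ) = (Nat.gcd r s : ℕ) * r' := by exact_mod_cast hr'
    have e2 : (s : ℤ) = (Nat.gcd r s : ℕ) * s' := by exact_mod_cast hs'
    linear_combination -h - Nat.gcdA r s * e1 - Nat.gcdB r s * e2
  refine equiv_of_ker (hom1 k r s) (hom2 k r s (Nat.gcd r s) r' s' u v hr' hs') hom1_surj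
    (hom2_surj hr' hs' huv) (fun z => ?_)
  exact (hom1_ker z).trans (hom2_ker hr' hs' huv z).symm
end

section
/- Let k be a field of characteristic 2. Then the quotient group H³(C₂×C₂, k*) = Z³(C₂×C₂,k*)/B³(C₂×C₂,k*) is isomorphic, as a group, to k*/k*^{(2)}, where k*^{(2)} = {α² : α ∈ k*}. In particular, if every element of k has a square root in k, then H³(C₂×C₂,k*) is trivial. -/
/-- The Klein four-group `C₂ × C₂`, written multiplicatively. -/
abbrev K : Type := Multiplicative (ZMod 2 × ZMod 2)

def σ : K := Multiplicative.ofAdd (1, 0)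
def τ : K := Multiplicative.ofAdd (0, 1)
def ρ : K := Multiplicative.ofAdd (1, 1)

section Klein

set_option linter.unusedSimpArgs false

theorem K_cases (x : K) : x = 1 ∨ x = σ ∨ x = τ ∨ x = ρ := by
  revert x; decide

theorem K_mul_self (x : K) : x * x = 1 := by
  revert x; decide

theorem K_st : σ * τ = ρ := by decide
theorem K_ts : τ * σ = ρ := by decide
theorem K_sr : σ * ρ = τ := by decide
theorem K_rs : ρ * σ = τ := by decide
theorem K_tr : τ * ρ = σ := by decide
theorem K_rt : ρ * τ = σ := by decide

theorem K_fun {A : Type*} (v : Fin 4 → A) :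
    ∃ g : K → A, g 1 = v 0 ∧ g σ = v 1 ∧ g τ = v 2 ∧ g ρ = v 3 :=
  ⟨fun x => if x = 1 then v 0 else if x = σ then v 1 else if x = τ then v 2 else v 3,
    by simp, by beta_reduce; rw [if_neg (by decide), if_pos rfl],
    by beta_reduce; rw [if_neg (by decide), if_neg (by decide), if_pos rfl],
    by beta_reduce; rw [if_neg (by decide), if_neg (by decide), if_neg (by decide)]⟩

theorem units_two {k : Type*} [Field k] (hk : ringChar k = 2) (u : kˣ) (h : u * u = 1) :
    u = 1 := by
  have : CharP k 2 := ringChar.of_eq hk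
  have h1 : (u : k) * u = 1 := by simpa using congrArg Units.val h
  have h0 : (2 : k) = 0 := CharTwo.two_eq_zero
  have h2 : ((u : k) - 1) ^ 2 = 0 := by
    linear_combination h1 + (1 - (u : k)) * h0
  have h3 := pow_eq_zero_iff (two_ne_zero) |>.1 h2
  exact Units.ext (sub_eq_zero.1 h3)

/-- A cocycle vanishing on twelve well-chosen triples is trivial. -/
theorem cocycle_trivial {k : Type*} [Field k] (hk : ringChar k = 2) (f : K → K → K → kˣ)
    (hc : IsCocycle f) (hl : ∀ x, f 1 1 x = 1) (hr : ∀ x, f x 1 1 = 1)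
    (h112 : f σ σ τ = 1) (h122 : f σ τ τ = 1) (h221 : f τ τ σ = 1) (h211 : f τ σ σ = 1)
    (h312 : f ρ σ τ = 1) (h212 : f τ σ τ = 1) : f = 1 := by
  have two := units_two hk
  have hss := K_mul_self
  have hst := K_st
  have hts := K_ts
  have hsr := K_sr
  have hrs := K_rs
  have htr := K_tr
  have hrt := K_rt
  have hm : ∀ x t, f x 1 t = 1 := fun x t => by simpa [hl, hr] using hc x 1 1 t
  have hL : ∀ x t, f 1 x t = 1 := fun x t => by simpa [hl] using hc 1 1 x t
  have hR : ∀ x t, f x t 1 = 1 := fun x t => by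
    have := hc x t 1 1
    simpa [hr] using this
  have hd : ∀ x, f x x x = 1 := fun x => by
    refine two _ ?_
    have := hc x x x x
    simpa [hss, hm, hL, hR] using this
  clear hl hr two
  have h113 : f σ σ ρ = 1 := by simpa [*] using (hc σ σ σ τ).symm
  have h132 : f σ ρ τ = 1 := by simpa [*] using hc σ σ τ τ
  have h311 : f ρ σ σ = 1 := by simpa [*] using (hc τ σ σ σ).symm
  have h213 : f τ σ ρ = 1 := by simpa [*] using (hc τ σ σ τ).symm
  have h313 : f ρ σ ρ = 1 := by simpa [*] using (hc τ σ σ ρ).symm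
  have h231 : f τ ρ σ = 1 := by simpa [*] using hc τ τ σ σ
  have h322 : f ρ τ τ = 1 := by simpa [*] using (hc σ τ τ τ).symm
  have h232 : f τ ρ τ = 1 := by simpa [*] using hc τ σ τ τ
  have h332 : f ρ ρ τ = 1 := by simpa [*] using (hc τ σ ρ τ).symm
  have h223 : f τ τ ρ = 1 := by simpa [*] using (hc τ τ σ τ).symm
  have h233 : f τ ρ ρ = 1 := by simpa [*] using hc τ τ σ ρ
  have h123 : f σ τ ρ = 1 := by simpa [*] using hc σ τ ρ ρ
  have h133 : f σ ρ ρ = 1 := by simpa [*] using hc σ σ τ ρ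
  have h121 : f σ τ σ = 1 := by simpa [*] using hc σ τ σ τ
  have h131 : f σ ρ σ = 1 := by simpa [*] using hc σ σ τ σ
  have h321 : f ρ τ σ = 1 := by simpa [*] using (hc σ τ τ σ).symm
  have h323 : f ρ τ ρ = 1 := by simpa [*] using (hc σ τ τ ρ).symm
  have h331 : f ρ ρ σ = 1 := by simpa [*] using (hc σ τ ρ σ).symm
  funext x y z
  rcases K_cases x with rfl | rfl | rfl | rfl <;> rcases K_cases y with rfl | rfl | rfl | rfl <;>
    rcases K_cases z with rfl | rfl | rfl | rfl <;> simp [*]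

/-- The invariant of a cocycle; it pairs `φ` with a chain of boundary `2 (τ|σ) - 2 (σ|τ)`. -/
def inv3 (k : Type*) [Field k] : (K → K → K → kˣ) →* kˣ where
  toFun φ := φ σ τ τ * φ τ τ σ * (φ τ σ τ)⁻¹ * φ σ 1 1 * φ 1 1 σ
  map_one' := by simp
  map_mul' a b := by
    simp only [Pi.mul_apply, mul_inv, mul_assoc, mul_left_comm, mul_comm]

theorem inv3_d2 {k : Type*} [Field k] (g : K → K → kˣ) :
    inv3 k (d2 g) = (g τ σ * (g σ τ)⁻¹) ^ 2 := by
  simp only [inv3, d2, MonoidHom.coe_mk, OneHom.coe_mk, K_mul_self, K_st, K_ts, K_sr, K_rs, K_tr,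
    K_rt, one_mul, mul_one]
  apply Units.ext
  push_cast
  field_simp

theorem isCocycle_d2 {k : Type*} [Field k] {G : Type*} [Group G] (g : G → G → kˣ) :
    IsCocycle (d2 g) := by
  intro x y z t
  simp only [d2, mul_assoc x y z, mul_assoc y z t]
  apply Units.ext
  push_cast
  field_simp

theorem coboundary_of_inv {k : Type*} [Field k] (hk : ringChar k = 2) (φ : K → K → K → kˣ)
    (hc : IsCocycle φ) (a : kˣ) (ha : inv3 k φ = a ^ 2) : IsCoboundary φ := by
  obtain ⟨g1, a1, a2, a3, a4⟩ := K_fun ![1, φ 1 1 σ, φ 1 1 τ, φ 1 1 ρ]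
  obtain ⟨g2, b1, b2, b3, b4⟩ := K_fun ![(φ σ 1 1)⁻¹, 1, 1, φ σ σ τ * φ 1 1 τ]
  obtain ⟨g3, c1, c2, c3, c4⟩ := K_fun ![(φ τ 1 1)⁻¹, a, 1, φ τ τ σ * a⁻¹ * φ 1 1 σ]
  obtain ⟨g4, d1, d2', d3, d4⟩ := K_fun ![(φ ρ 1 1)⁻¹, (φ τ 1 1)⁻¹ * a⁻¹ * (φ τ σ σ)⁻¹,
    (φ σ 1 1)⁻¹ * (φ σ τ τ)⁻¹, φ ρ σ τ * ((φ τ 1 1)⁻¹ * a⁻¹ * (φ τ σ σ)⁻¹)]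
  obtain ⟨g, e1, e2, e3, e4⟩ := K_fun ![g1, g2, g3, g4]
  simp only [Matrix.cons_val] at a1 a2 a3 a4 b1 b2 b3 b4 c1 c2 c3 c4 d1 d2' d3 d4 e1 e2 e3 e4
  have h1 : φ 1 1 1 = 1 := by simpa using hc 1 1 1 1
  have key : φ * (d2 g)⁻¹ = 1 := by
    apply cocycle_trivial hk
    · exact (Z3 k K).mul_mem hc ((Z3 k K).inv_mem (isCocycle_d2 g))
    · intro x
      rcases K_cases x with rfl | rfl | rfl | rfl <;>
        simp [d2, *]
    · intro x
      rcases K_cases x with rfl | rfl | rfl | rfl <;>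
        simp [d2, *]
    · simp only [d2, Pi.mul_apply, Pi.inv_apply, K_mul_self, K_st, K_ts, K_sr, K_rs, K_tr, K_rt,
        e1, e2, e3, e4, a1, a2, a3, a4, b1, b2, b3, b4, c1, c2, c3, c4, d1, d2', d3, d4]
      apply Units.ext
      push_cast
      field_simp
    · simp only [d2, Pi.mul_apply, Pi.inv_apply, K_mul_self, K_st, K_ts, K_sr, K_rs, K_tr, K_rt,
        e1, e2, e3, e4, a1, a2, a3, a4, b1, b2, b3, b4, c1, c2, c3, c4, d1, d2', d3, d4]
      apply Units.ext
      push_cast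
      field_simp
    · simp only [d2, Pi.mul_apply, Pi.inv_apply, K_mul_self, K_st, K_ts, K_sr, K_rs, K_tr, K_rt,
        e1, e2, e3, e4, a1, a2, a3, a4, b1, b2, b3, b4, c1, c2, c3, c4, d1, d2', d3, d4]
      apply Units.ext
      push_cast
      field_simp
    · simp only [d2, Pi.mul_apply, Pi.inv_apply, K_mul_self, K_st, K_ts, K_sr, K_rs, K_tr, K_rt,
        e1, e2, e3, e4, a1, a2, a3, a4, b1, b2, b3, b4, c1, c2, c3, c4, d1, d2', d3, d4]
      apply Units.ext
      push_cast
      field_simp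
    · simp only [d2, Pi.mul_apply, Pi.inv_apply, K_mul_self, K_st, K_ts, K_sr, K_rs, K_tr, K_rt,
        e1, e2, e3, e4, a1, a2, a3, a4, b1, b2, b3, b4, c1, c2, c3, c4, d1, d2', d3, d4]
      apply Units.ext
      push_cast
      field_simp
    · have ha' : φ σ τ τ * φ τ τ σ * (φ τ σ τ)⁻¹ * φ σ 1 1 * φ 1 1 σ = a ^ 2 := ha
      simp only [d2, Pi.mul_apply, Pi.inv_apply, K_mul_self, K_st, K_ts, K_sr, K_rs, K_tr, K_rt,
        e1, e2, e3, e4, a1, a2, a3, a4, b1, b2, b3, b4, c1, c2, c3, c4, d1, d2', d3, d4]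
      have ha2 : φ τ σ τ = φ σ τ τ * φ τ τ σ * φ σ 1 1 * φ 1 1 σ * (a ^ 2)⁻¹ := by
        rw [← ha']
        apply Units.ext
        push_cast
        field_simp
      rw [ha2]
      apply Units.ext
      push_cast
      field_simp
  exact ⟨g, mul_inv_eq_one.1 key⟩

/-- Integer lift of the bilinear form `x₁ y₂`. -/
def beta (x y : K) : ℤ :=
  if (Multiplicative.toAdd x).1 = 1 ∧ (Multiplicative.toAdd y).2 = 1 then -1 else 0

/-- Half of the coboundary of `beta`. -/
def halfBeta (x y z : K) : ℤ :=
  (beta y z - beta (x * y) z + beta x (y * z) - beta x y) / 2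

theorem halfBeta_cocycle : ∀ x y z t : K,
    halfBeta y z t + halfBeta x (y * z) t + halfBeta x y z =
      halfBeta (x * y) z t + halfBeta x y (z * t) := by
  decide

theorem exists_cocycle {k : Type*} [Field k] (c : kˣ) :
    ∃ φ : K → K → K → kˣ, IsCocycle φ ∧ inv3 k φ = c := by
  refine ⟨fun x y z => c ^ halfBeta x y z, fun x y z t => ?_, ?_⟩
  · simp only [← zpow_add, halfBeta_cocycle]
  · simp only [inv3, MonoidHom.coe_mk, OneHom.coe_mk, ← zpow_neg, ← zpow_add]
    have : halfBeta σ τ τ + halfBeta τ τ σ + -halfBeta τ σ τ + halfBeta σ 1 1 + halfBeta 1 1 σ = 1 := by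
      decide
    rw [this, zpow_one]

/-- The invariant modulo squares, on cocycles. -/
def invHom (k : Type*) [Field k] : Z3 k K →* kˣ ⧸ powSubgroup k 2 :=
  ((QuotientGroup.mk' (powSubgroup k 2)).comp (inv3 k)).comp (Z3 k K).subtype

theorem invHom_surjective (k : Type*) [Field k] : Function.Surjective (invHom k) := by
  intro q
  obtain ⟨c, rfl⟩ := QuotientGroup.mk'_surjective _ q
  obtain ⟨φ, hφ, rfl⟩ := exists_cocycle c
  exact ⟨⟨φ, hφ⟩, rfl⟩

theorem invHom_ker (k : Type*) [Field k] (hk : ringChar k = 2) :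
    (invHom k).ker = (B3 k K).subgroupOf (Z3 k K) := by
  ext ⟨φ, hφ⟩
  rw [MonoidHom.mem_ker, Subgroup.mem_subgroupOf]
  have h : invHom k ⟨φ, hφ⟩ = 1 ↔ inv3 k φ ∈ powSubgroup k 2 :=
    QuotientGroup.eq_one_iff _
  rw [h]
  constructor
  · rintro ⟨a, ha⟩
    exact coboundary_of_inv hk φ hφ a ha.symm
  · rintro ⟨g, hg⟩
    change φ = d2 g at hg
    subst hg
    exact ⟨_, (inv3_d2 g).symm⟩

end Klein

theorem statement13 (k : Type*) [Field k] (hk : ringChar k = 2) :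
    Nonempty (H3 k K ≃* kˣ ⧸ powSubgroup k 2) ∧
    ((∀ α : k, ∃ β : k, β ^ 2 = α) → Subsingleton (H3 k K)) := by
  have e : H3 k K ≃* kˣ ⧸ powSubgroup k 2 :=
    (QuotientGroup.quotientMulEquivOfEq (invHom_ker k hk).symm).trans
      (QuotientGroup.quotientKerEquivOfSurjective (invHom k) (invHom_surjective k))
  refine ⟨⟨e⟩, fun h => ?_⟩
  have htop : powSubgroup k 2 = ⊤ := by
    rw [eq_top_iff]
    intro u _
    obtain ⟨β, hβ⟩ := h u
    have hb : β ≠ 0 := by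
      rintro rfl
      exact u.ne_zero (by simpa using hβ.symm)
    exact ⟨Units.mk0 β hb, Units.ext (by simpa using hβ)⟩
  have : Subsingleton (kˣ ⧸ powSubgroup k 2) := by
    rw [htop]
    exact QuotientGroup.subsingleton_quotient_top
  exact e.toEquiv.subsingleton
end
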